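/- arXiv:1808.07266 — 2 statements merged into one kernel-verified Lean document; each statement's English description precedes it below -/
import Mathlib

section
/- Let G be a finite simple graph on [r] = {1,…,r} and let p be a vertex with 1 ≤ deg p ≤ 2. Then for every a ∈ ℕ^r and every n ≥ 1, p is not an isolated vertex of Δ_a(I_G^n); that is, it is impossible that simultaneously x^a ∉ (I_G[{p}]S)^n and x^a ∈ (I_G[{p,j}]S)^n for every j ≠ p. -/
open MvPolynomial

/-- The Stanley–Reisner ideal of a graph viewed as a one-dimensional simplicial complex. -/
noncomputable def SRIdeal (K : Type*) [Field K] {r : ℕ} (G : SimpleGraph (Fin r)) :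
    Ideal (MvPolynomial (Fin r) K) :=
  Ideal.span
    ({p | ∃ i j : Fin r, i ≠ j ∧ ¬ G.Adj i j ∧ p = X i * X j} ∪
     {p | ∃ i j k : Fin r, i ≠ j ∧ i ≠ k ∧ j ≠ k ∧ p = X i * X j * X k})

/-- Monomial localization `I_G[F]S`. -/
noncomputable def locSR (K : Type*) [Field K] {r : ℕ} (G : SimpleGraph (Fin r))
    (F : Finset (Fin r)) : Ideal (MvPolynomial (Fin r) K) :=
  Ideal.map (aeval (fun i : Fin r => if i ∈ F then 1 else X i) :
      MvPolynomial (Fin r) K →ₐ[K] MvPolynomial (Fin r) K) (SRIdeal K G)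

theorem sum_ge_of_mem_locSR_pow (K : Type*) [Field K] {r : ℕ} (G : SimpleGraph (Fin r))
    {p u : Fin r} (hpu : G.Adj p u) (a : Fin r → ℕ) (n : ℕ)
    (h : (∏ i, (X i : MvPolynomial (Fin r) K) ^ a i) ∈ (locSR K G {p, u}) ^ n) :
    n ≤ ∑ i ∈ Finset.univ \ {p, u}, a i := by
  classical
  let φ : MvPolynomial (Fin r) K →ₐ[K] Polynomial K :=
    aeval fun i => if i ∈ ({p, u} : Finset (Fin r)) then 1 else Polynomial.X
  have hφ : ∀ i, φ (X i) = if i ∈ ({p, u} : Finset (Fin r)) then 1 else Polynomial.X :=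
    fun i => aeval_X _ i
  have hloc : locSR K G {p, u} ≤ (Ideal.span {(Polynomial.X : Polynomial K)}).comap φ := by
    rw [locSR, Ideal.map_le_iff_le_comap, SRIdeal, Ideal.span_le]
    have key : ∀ i, i ∉ ({p, u} : Finset (Fin r)) →
        (Polynomial.X : Polynomial K) ∣ φ ((aeval (fun i : Fin r =>
          if i ∈ ({p, u} : Finset (Fin r)) then 1 else X i) :
          MvPolynomial (Fin r) K →ₐ[K] MvPolynomial (Fin r) K) (X i)) := by
      intro i hi
      rw [aeval_X, if_neg hi, hφ, if_neg hi]
    rintro _ (⟨i, j, hij, hadj, rfl⟩ | ⟨i, j, k, hij, hik, hjk, rfl⟩)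
    · simp only [SetLike.mem_coe, Ideal.mem_comap, Ideal.mem_span_singleton, map_mul]
      by_cases hi : i ∈ ({p, u} : Finset (Fin r))
      · refine Dvd.dvd.mul_left (key j fun hj => ?_) _
        have := hpu.symm
        simp only [Finset.mem_insert, Finset.mem_singleton] at hi hj
        grind
      · exact Dvd.dvd.mul_right (key i hi) _
    · simp only [SetLike.mem_coe, Ideal.mem_comap, Ideal.mem_span_singleton, map_mul]
      by_cases hi : i ∈ ({p, u} : Finset (Fin r))
      · by_cases hj : j ∈ ({p, u} : Finset (Fin r))
        · refine Dvd.dvd.mul_left (key k fun hk => ?_) _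
          simp only [Finset.mem_insert, Finset.mem_singleton] at hi hj hk
          grind
        · exact Dvd.dvd.mul_right (Dvd.dvd.mul_left (key j hj) _) _
      · exact Dvd.dvd.mul_right (Dvd.dvd.mul_right (key i hi) _) _
  have h1 := Ideal.mem_map_of_mem φ h
  rw [Ideal.map_pow] at h1
  have h2 := Ideal.pow_right_mono (Ideal.map_le_iff_le_comap.mpr hloc) n h1
  rw [Ideal.span_singleton_pow, Ideal.mem_span_singleton, map_prod] at h2
  have h3 : ∏ i, φ ((X i : MvPolynomial (Fin r) K) ^ a i) =
      Polynomial.X ^ ∑ i ∈ Finset.univ \ {p, u}, a i := by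
    rw [← Finset.prod_pow_eq_pow_sum, ← Finset.prod_subset (Finset.sdiff_subset)]
    · refine Finset.prod_congr rfl fun i hi => ?_
      rw [map_pow, hφ, if_neg (Finset.mem_sdiff.mp hi).2]
    · intro i _ hi
      have hi' : i ∈ ({p, u} : Finset (Fin r)) := by simpa [or_iff_not_imp_left] using hi
      rw [map_pow, hφ, if_pos hi', one_pow]
  rw [h3] at h2
  exact (pow_dvd_pow_iff Polynomial.X_ne_zero Polynomial.not_isUnit_X).mp h2

theorem X_mem_locSR_singleton (K : Type*) [Field K] {r : ℕ} (G : SimpleGraph (Fin r))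
    {p i : Fin r} (hip : i ≠ p) (hpi : ¬ G.Adj p i) :
    (X i : MvPolynomial (Fin r) K) ∈ locSR K G {p} := by
  have h : (X p * X i : MvPolynomial (Fin r) K) ∈ SRIdeal K G :=
    Ideal.subset_span (Or.inl ⟨p, i, hip.symm, hpi, rfl⟩)
  simpa [locSR, hip] using Ideal.mem_map_of_mem (aeval (fun i : Fin r =>
    if i ∈ ({p} : Finset (Fin r)) then 1 else X i) :
      MvPolynomial (Fin r) K →ₐ[K] MvPolynomial (Fin r) K) h

theorem X_mul_X_mem_locSR_singleton (K : Type*) [Field K] {r : ℕ} (G : SimpleGraph (Fin r))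
    {p i j : Fin r} (hip : i ≠ p) (hjp : j ≠ p) (hij : i ≠ j) :
    (X i * X j : MvPolynomial (Fin r) K) ∈ locSR K G {p} := by
  have h : (X p * X i * X j : MvPolynomial (Fin r) K) ∈ SRIdeal K G :=
    Ideal.subset_span (Or.inr ⟨p, i, j, hip.symm, hjp.symm, hij, rfl⟩)
  simpa [locSR, hip, hjp] using Ideal.mem_map_of_mem (aeval (fun i : Fin r =>
    if i ∈ ({p} : Finset (Fin r)) then 1 else X i) :
      MvPolynomial (Fin r) K →ₐ[K] MvPolynomial (Fin r) K) h

theorem prod_X_pow_mem_pow_sum {K σ : Type*} [Field K] (I : Ideal (MvPolynomial σ K))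
    (s : Finset σ) (hs : ∀ i ∈ s, X i ∈ I) (a : σ → ℕ) :
    ∏ i ∈ s, X i ^ a i ∈ I ^ ∑ i ∈ s, a i := by
  rw [← Finset.prod_pow_eq_pow_sum]
  exact Ideal.prod_mem_prod fun i hi => Ideal.pow_mem_pow (hs i hi) _

theorem stmt_11 (K : Type*) [Field K] {r : ℕ} (G : SimpleGraph (Fin r))
    [DecidableRel G.Adj] (p : Fin r) (hp1 : 1 ≤ G.degree p) (hp2 : G.degree p ≤ 2)
    (a : Fin r → ℕ) (n : ℕ) (hn : 1 ≤ n) :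
    ¬ ((∏ i, (X i : MvPolynomial (Fin r) K) ^ a i) ∉ (locSR K G {p}) ^ n ∧
      ∀ j : Fin r, j ≠ p →
        (∏ i, (X i : MvPolynomial (Fin r) K) ^ a i) ∈ (locSR K G {p, j}) ^ n) := by
  rintro ⟨hnot, hmem⟩
  apply hnot
  obtain hdeg | hdeg : G.degree p = 1 ∨ G.degree p = 2 := by omega
  · obtain ⟨u, hu⟩ := Finset.card_eq_one.mp hdeg
    have hN : ∀ i, G.Adj p i ↔ i = u := fun i => by
      rw [← G.mem_neighborFinset, hu, Finset.mem_singleton]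
    have hpu : G.Adj p u := (hN u).mpr rfl
    refine Ideal.pow_le_pow_right
      (sum_ge_of_mem_locSR_pow K G hpu a n (hmem u hpu.ne')) ?_
    refine Ideal.mem_of_dvd _ (Finset.prod_dvd_prod_of_subset _ _ _ Finset.sdiff_subset)
      (prod_X_pow_mem_pow_sum _ (Finset.univ \ {p, u}) (fun i hi => ?_) a)
    simp only [Finset.mem_sdiff, Finset.mem_univ, true_and, Finset.mem_insert,
      Finset.mem_singleton, not_or] at hi
    exact X_mem_locSR_singleton K G hi.1 (by rw [hN]; exact hi.2)
  · obtain ⟨u, v, huv, hN'⟩ := Finset.card_eq_two.mp hdeg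
    have hN : ∀ i, G.Adj p i ↔ i = u ∨ i = v := fun i => by
      rw [← G.mem_neighborFinset, hN', Finset.mem_insert, Finset.mem_singleton]
    have hpu : G.Adj p u := (hN u).mpr (Or.inl rfl)
    have hpv : G.Adj p v := (hN v).mpr (Or.inr rfl)
    have hsu := sum_ge_of_mem_locSR_pow K G hpu a n (hmem u hpu.ne')
    have hsv := sum_ge_of_mem_locSR_pow K G hpv a n (hmem v hpv.ne')
    set s : Finset (Fin r) := Finset.univ \ {p, u, v} with hs
    have hus : u ∉ s := by simp [hs]
    have hvs : v ∉ s := by simp [hs]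
    have hu' : Finset.univ \ {p, u} = insert v s := by
      ext i; have := hpv.ne'; simp [hs]; grind
    have hv' : Finset.univ \ {p, v} = insert u s := by
      ext i; have := hpu.ne'; simp [hs]; grind
    rw [hu', Finset.sum_insert hvs] at hsu
    rw [hv', Finset.sum_insert hus] at hsv
    have hle : n ≤ min (a u) (a v) + ∑ i ∈ s, a i := by omega
    refine Ideal.pow_le_pow_right hle ?_
    have hprod := prod_X_pow_mem_pow_sum (locSR K G {p}) s (fun i hi => by
      simp only [hs, Finset.mem_sdiff, Finset.mem_univ, true_and, Finset.mem_insert,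
        Finset.mem_singleton, not_or] at hi
      exact X_mem_locSR_singleton K G hi.1 (by rw [hN]; tauto)) a
    have hpow := Ideal.pow_mem_pow
      (X_mul_X_mem_locSR_singleton K G hpu.ne' hpv.ne' huv) (min (a u) (a v))
    have hall := Ideal.mul_mem_mul hpow hprod
    rw [← pow_add] at hall
    refine Ideal.mem_of_dvd _ ?_ hall
    refine dvd_trans ?_ (Finset.prod_dvd_prod_of_subset (insert u (insert v s)) _ _
      (Finset.subset_univ _))
    rw [Finset.prod_insert (by simp [huv, hus]), Finset.prod_insert hvs, mul_pow, ← mul_assoc]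
    exact mul_dvd_mul_right (mul_dvd_mul (pow_dvd_pow _ (min_le_left _ _))
      (pow_dvd_pow _ (min_le_right _ _))) _
end

section
/- Let G be the 5-cycle on [5] = {1,2,3,4,5}, with edges {1,2},{2,3},{3,4},{4,5},{5,1}. Then for every a ∈ ℕ^5 the complex Δ_a(I_G^2) is connected: any two vertices p, q of Δ_a(I_G^2) can be joined by a path consisting of edges of Δ_a(I_G^2). -/
open MvPolynomial

/-- `p` is a vertex of the degree complex `Δ_a(I_G^n)`. -/
def DeltaVert (K : Type*) [Field K] {r : ℕ} (G : SimpleGraph (Fin r))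
    (n : ℕ) (a : Fin r → ℕ) (p : Fin r) : Prop :=
  (∏ i, (X i : MvPolynomial (Fin r) K) ^ a i) ∉ (locSR K G {p}) ^ n

/-- `{p,q}` is an edge of the degree complex `Δ_a(I_G^n)`. -/
def DeltaEdge (K : Type*) [Field K] {r : ℕ} (G : SimpleGraph (Fin r))
    (n : ℕ) (a : Fin r → ℕ) (p q : Fin r) : Prop :=
  p ≠ q ∧ (∏ i, (X i : MvPolynomial (Fin r) K) ^ a i) ∉ (locSR K G {p, q}) ^ n

/-- The degree complex `Δ_a(I_G^n)` is disconnected: two of its vertices cannot be joined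
by a path consisting of its edges. -/
def DeltaDisconnected (K : Type*) [Field K] {r : ℕ} (G : SimpleGraph (Fin r))
    (n : ℕ) (a : Fin r → ℕ) : Prop :=
  ∃ p q : Fin r, DeltaVert K G n a p ∧ DeltaVert K G n a q ∧
    ¬ ∃ (ℓ : ℕ) (f : ℕ → Fin r), f 0 = p ∧ f ℓ = q ∧
        ∀ i < ℓ, DeltaEdge K G n a (f i) (f (i + 1))

/-- A vertex of `G` is compact if it has degree `≥ 3` and lies in a triangle. -/
def IsCompactVertex {r : ℕ} (G : SimpleGraph (Fin r)) [DecidableRel G.Adj]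
    (v : Fin r) : Prop :=
  3 ≤ G.degree v ∧ ∃ x y : Fin r, G.Adj v x ∧ G.Adj v y ∧ G.Adj x y

lemma DeltaEdge.symm {K : Type*} [Field K] {r : ℕ} {G : SimpleGraph (Fin r)} {n : ℕ}
    {a : Fin r → ℕ} {p q : Fin r} (h : DeltaEdge K G n a p q) : DeltaEdge K G n a q p :=
  ⟨h.1.symm, Finset.pair_comm p q ▸ h.2⟩

/-- The graph formed by the edges of the degree complex `Δ_a(I_G^n)`. -/
def deltaGraph (K : Type*) [Field K] {r : ℕ} (G : SimpleGraph (Fin r)) (n : ℕ)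
    (a : Fin r → ℕ) : SimpleGraph (Fin r) where
  Adj := DeltaEdge K G n a
  symm := ⟨fun _ _ => DeltaEdge.symm⟩
  loopless := ⟨fun _ h => h.1 rfl⟩

lemma mul_mem_locSR (K : Type*) [Field K] {r : ℕ} {G : SimpleGraph (Fin r)}
    (F : Finset (Fin r)) {i j : Fin r} (hij : i ≠ j) (hG : ¬ G.Adj i j) :
    ((if i ∈ F then 1 else X i) * (if j ∈ F then 1 else X j) : MvPolynomial (Fin r) K) ∈
      locSR K G F := by
  have h := Ideal.mem_map_of_mem
    (aeval (fun i : Fin r => if i ∈ F then 1 else X i) :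
      MvPolynomial (Fin r) K →ₐ[K] MvPolynomial (Fin r) K)
    (Ideal.subset_span (Or.inl ⟨i, j, hij, hG, rfl⟩) : X i * X j ∈ SRIdeal K G)
  rwa [map_mul, aeval_X, aeval_X] at h

lemma mul_mul_mem_locSR (K : Type*) [Field K] {r : ℕ} (G : SimpleGraph (Fin r))
    (F : Finset (Fin r)) {i j k : Fin r} (hij : i ≠ j) (hik : i ≠ k) (hjk : j ≠ k) :
    ((if i ∈ F then 1 else X i) * (if j ∈ F then 1 else X j) * (if k ∈ F then 1 else X k) :
      MvPolynomial (Fin r) K) ∈ locSR K G F := by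
  have h := Ideal.mem_map_of_mem
    (aeval (fun i : Fin r => if i ∈ F then 1 else X i) :
      MvPolynomial (Fin r) K →ₐ[K] MvPolynomial (Fin r) K)
    (Ideal.subset_span (Or.inr ⟨i, j, k, hij, hik, hjk, rfl⟩) : X i * X j * X k ∈ SRIdeal K G)
  rwa [map_mul, map_mul, aeval_X, aeval_X, aeval_X] at h

/-- An edge `{p,q}` of `G` is an edge of `Δ_a(I_G^n)` as soon as the exponents of `x^a` off
`{p,q}` add up to less than `n`. -/
lemma deltaEdge_of_sum_lt (K : Type*) [Field K] {r : ℕ} {G : SimpleGraph (Fin r)} {n : ℕ}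
    {a : Fin r → ℕ} {p q : Fin r} (hpq : G.Adj p q)
    (ha : ∑ k with k ∉ ({p, q} : Finset (Fin r)), a k < n) : DeltaEdge K G n a p q := by
  refine ⟨hpq.ne, fun hmem => ?_⟩
  set F : Finset (Fin r) := {p, q}
  let φ : MvPolynomial (Fin r) K →ₐ[K] Polynomial K :=
    aeval fun k => if k ∈ F then 1 else Polynomial.X
  have hX (k : Fin r) (hk : k ∉ F) : φ (if k ∈ F then 1 else X k) = Polynomial.X := by
    simp [φ, hk]
  have hle : (locSR K G F).map φ ≤ Ideal.span {Polynomial.X} := by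
    rw [locSR, SRIdeal, Ideal.map_span, Ideal.map_span, Ideal.span_le]
    rintro _ ⟨_, ⟨_, (⟨i, j, hij, hG, rfl⟩ | ⟨i, j, k, hij, hik, hjk, rfl⟩), rfl⟩, rfl⟩
    · simp only [map_mul, aeval_X, SetLike.mem_coe, Ideal.mem_span_singleton]
      have : i ∉ F ∨ j ∉ F := by
        by_contra! h
        obtain ⟨hi, hj⟩ := h
        simp only [F, Finset.mem_insert, Finset.mem_singleton] at hi hj
        grind [SimpleGraph.adj_comm]
      rcases this with h | h <;> rw [hX _ h]
      · exact dvd_mul_right _ _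
      · exact dvd_mul_left _ _
    · simp only [map_mul, aeval_X, SetLike.mem_coe, Ideal.mem_span_singleton]
      have : i ∉ F ∨ j ∉ F ∨ k ∉ F := by
        simp only [F, Finset.mem_insert, Finset.mem_singleton]
        grind
      rcases this with h | h | h <;> rw [hX _ h]
      · exact (dvd_mul_right _ _).mul_right _
      · exact (dvd_mul_left _ _).mul_right _
      · exact dvd_mul_left _ _
  have hφ : φ (∏ i, X i ^ a i) = Polynomial.X ^ ∑ k with k ∉ F, a k := by
    simp [φ, ite_pow, Finset.prod_ite, Finset.prod_pow_eq_pow_sum]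
  have h := Ideal.mem_map_of_mem φ hmem
  rw [Ideal.map_pow] at h
  have h' := Ideal.pow_right_mono hle n h
  rw [hφ, Ideal.span_singleton_pow, Ideal.mem_span_singleton] at h'
  exact absurd ((pow_dvd_pow_iff Polynomial.X_ne_zero Polynomial.not_isUnit_X).1 h') (by omega)

lemma fin_five_prod_eq {M : Type*} [CommMonoid M] (f : Fin 5 → M) (p : Fin 5) :
    ∏ i, f i = f p * (f (p + 2) * f (p + 3) * (f (p + 1) * f (p + 4))) := by
  rw [← Equiv.prod_comp (Equiv.addLeft p) f, Fin.prod_univ_five]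
  simp only [Equiv.coe_addLeft, add_zero]
  ac_rfl

/-- The 5-cycle. -/
abbrev fiveCycle : SimpleGraph (Fin 5) := SimpleGraph.fromRel fun u v => v = u + 1

lemma DeltaVert.fiveCycle_lt {K : Type*} [Field K] {n : ℕ} {a : Fin 5 → ℕ} {p : Fin 5}
    (hp : DeltaVert K fiveCycle n a p) :
    a (p + 2) + a (p + 3) + min (a (p + 1)) (a (p + 4)) < n := by
  by_contra! hn
  refine hp ?_
  set I := locSR K fiveCycle {p}
  set m := min (a (p + 1)) (a (p + 4))
  have h2 : X (p + 2) ∈ I := by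
    have h := mul_mem_locSR K (G := fiveCycle) {p} (i := p) (j := p + 2)
      (by simp) (by simp only [SimpleGraph.fromRel_adj]; clear * -; revert p; decide)
    simpa using h
  have h3 : X (p + 3) ∈ I := by
    have h := mul_mem_locSR K (G := fiveCycle) {p} (i := p) (j := p + 3)
      (by simp) (by simp only [SimpleGraph.fromRel_adj]; clear * -; revert p; decide)
    simpa using h
  have h14 : X (p + 1) * X (p + 4) ∈ I := by
    have h := mul_mul_mem_locSR K fiveCycle {p} (i := p) (j := p + 1) (k := p + 4)
      (by simp) (by simp) (by simp)
    simpa using h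
  have hmem : X (p + 2) ^ a (p + 2) * X (p + 3) ^ a (p + 3) * (X (p + 1) * X (p + 4)) ^ m ∈
      I ^ n := by
    refine Ideal.pow_le_pow_right hn ?_
    rw [pow_add, pow_add]
    exact Ideal.mul_mem_mul (Ideal.mul_mem_mul (Ideal.pow_mem_pow h2 _) (Ideal.pow_mem_pow h3 _))
      (Ideal.pow_mem_pow h14 _)
  refine Ideal.mem_of_dvd _ ?_ hmem
  rw [fin_five_prod_eq _ p, mul_pow]
  exact (mul_dvd_mul_left _ (mul_dvd_mul (pow_dvd_pow _ (min_le_left _ _))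
    (pow_dvd_pow _ (min_le_right _ _)))).mul_left _

lemma deltaGraph_fiveCycle_adj (K : Type*) [Field K] {n : ℕ} {a : Fin 5 → ℕ} {p : Fin 5}
    (h : a (p + 2) + a (p + 3) + a (p + 4) < n) :
    (deltaGraph K fiveCycle n a).Adj p (p + 1) := by
  refine deltaEdge_of_sum_lt K (by simp [SimpleGraph.fromRel_adj]) ?_
  have : ({k | k ∉ ({p, p + 1} : Finset (Fin 5))} : Finset (Fin 5)) = {p + 2, p + 3, p + 4} := by
    clear * -; revert p; decide
  rw [this, Finset.sum_insert (by simp), Finset.sum_insert (by simp), Finset.sum_singleton]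
  omega

/-- If the cyclic exponent condition making `{i, i+1}` an edge holds at `i` and at `j`, then
`i` and `j` lie in the same component. -/
lemma reachable_of_cyclic_sum_lt {H : SimpleGraph (Fin 5)} {a : Fin 5 → ℕ}
    (hH : ∀ i, a (i + 2) + a (i + 3) + a (i + 4) < 2 → H.Adj i (i + 1)) {i j : Fin 5}
    (hi : a (i + 2) + a (i + 3) + a (i + 4) < 2) (hj : a (j + 2) + a (j + 3) + a (j + 4) < 2) :
    H.Reachable i j := by
  have key (i : Fin 5) (hi : a (i + 2) + a (i + 3) + a (i + 4) < 2)
      (hj : a (i + 4) + a i + a (i + 1) < 2) : H.Reachable i (i + 2) := by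
    have h0 := hH i hi
    have h1 := hH (i + 1)
    have h2 := hH (i + 2)
    have h3 := hH (i + 3)
    have h4 := hH (i + 4)
    simp only [add_assoc i, Fin.reduceAdd, add_zero] at h0 h1 h2 h3 h4
    by_cases hc : a (i + 3) + a (i + 4) + a i < 2
    · exact h0.reachable.trans (h1 hc).reachable
    · exact ((h4 (by omega)).symm.reachable.trans (h3 (by omega)).symm.reachable).trans
        (h2 hj).symm.reachable
  obtain ⟨d, rfl⟩ : ∃ d, j = i + d := ⟨j - i, by simp⟩
  fin_cases d
  · simp
  · exact (hH i hi).reachable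
  · simp only [Fin.reduceFinMk, add_assoc i, Fin.reduceAdd, add_zero] at hj ⊢
    exact key i hi hj
  · have := key (i + 3)
    simp only [Fin.reduceFinMk, add_assoc i, Fin.reduceAdd, add_zero] at hj this ⊢
    exact (this hj (by omega)).symm
  · have := hH (i + 4)
    simp only [Fin.reduceFinMk, add_assoc i, Fin.reduceAdd, add_zero] at hj this ⊢
    exact (this hj).symm.reachable

/-- for the 5-cycle `G`, the complex `Δ_a(I_G^2)` is connected for all `a`. -/
theorem stmt_19 (K : Type*) [Field K]
    (G : SimpleGraph (Fin 5))
    (hG : G = SimpleGraph.fromRel (fun u v : Fin 5 => v = u + 1))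
    (a : Fin 5 → ℕ) (p q : Fin 5)
    (hp : DeltaVert K G 2 a p) (hq : DeltaVert K G 2 a q) :
    ∃ (ℓ : ℕ) (f : ℕ → Fin 5), f 0 = p ∧ f ℓ = q ∧
      ∀ i < ℓ, DeltaEdge K G 2 a (f i) (f (i + 1)) := by
  subst hG
  have hH (i : Fin 5) (hi : a (i + 2) + a (i + 3) + a (i + 4) < 2) :=
    deltaGraph_fiveCycle_adj K hi
  have hvert (v : Fin 5) (hv : DeltaVert K fiveCycle 2 a v) :
      ∃ i, a (i + 2) + a (i + 3) + a (i + 4) < 2 ∧ (deltaGraph K fiveCycle 2 a).Reachable v i := by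
    have hlt := hv.fiveCycle_lt
    by_cases h : a (v + 2) + a (v + 3) + a (v + 4) < 2
    · exact ⟨v, h, .rfl⟩
    · have h4 := hH (v + 4)
      refine ⟨v + 4, ?_, ?_⟩ <;> simp only [add_assoc v, Fin.reduceAdd, add_zero] at h4 ⊢
      · omega
      · exact (h4 (by omega)).symm.reachable
  obtain ⟨i, hi, hpi⟩ := hvert p hp
  obtain ⟨j, hj, hqj⟩ := hvert q hq
  obtain ⟨w⟩ := (hpi.trans (reachable_of_cyclic_sum_lt hH hi hj)).trans hqj.symm
  exact ⟨w.length, w.getVert, w.getVert_zero, w.getVert_length, fun _ => w.adj_getVert_succ⟩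
end
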